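/- (Decay of $Ta$ outside the dilated cube.) Let $N\ge 0$ be an integer and let $T$ be a Calderón–Zygmund operator associated with a kernel $K$ satisfying $|\partial_y^\beta K(x,y+h)-\partial_y^\beta K(x,y)|\le C|h|^\delta|x-y|^{-(n+N+\delta)}$ for all $x\ne y$, $|h|\le|x-y|/2$, and all multi-indices $|\beta|=N$. Then there is a constant $C'$ such that for every $(N,\infty)$ atom $a$ with $\operatorname{supp}(a)\subset Q$, denoting by $c$ the center of $Q$ and by $\ell(Q)$ its side length, for all $y\in(Q^*)^c$, $$|Ta(y)|\le C'\,\frac{\ell(Q)^{n+N+\delta}}{|y-c|^{n+N+\delta}}.$$ -/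

import Mathlib

open MeasureTheory ENNReal Filter Topology

noncomputable section

/-- Euclidean space `ℝⁿ`. -/
abbrev Rn (n : ℕ) := EuclideanSpace ℝ (Fin n)

variable {n : ℕ}

/-- The closed axis-parallel cube with center `c` and half side length `r`. -/
def stdCube (c : Rn n) (r : ℝ) : Set (Rn n) := {y | ∀ i, |y i - c i| ≤ r}

/-- A cube with sides parallel to the coordinate axes. -/
def IsCube (Q : Set (Rn n)) : Prop := ∃ (c : Rn n) (r : ℝ), 0 < r ∧ Q = stdCube c r

/-- The average `⨍_Q f` of `f` over `Q`. -/
def cubeAvg (Q : Set (Rn n)) (f : Rn n → ℝ) : ℝ := (volume Q).toReal⁻¹ * ∫ y in Q, f y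

/-- The average `⨍_Q f` of a nonnegative function over `Q`, computed in `ℝ≥0∞`. -/
def cubeAvgE (Q : Set (Rn n)) (f : Rn n → ℝ) : ℝ≥0∞ :=
  (∫⁻ y in Q, ENNReal.ofReal (f y)) / volume Q

/-- The `L^q` average `(⨍_Q f^q)^{1/q}` of a nonnegative function over `Q`, in `ℝ≥0∞`. -/
def cubeAvgEq (Q : Set (Rn n)) (f : Rn n → ℝ) (q : ℝ) : ℝ≥0∞ :=
  ((∫⁻ y in Q, ENNReal.ofReal (f y) ^ q) / volume Q) ^ (1/q)

/-- A weight: a nonnegative locally integrable function, positive a.e. -/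
def IsWeight (w : Rn n → ℝ) : Prop :=
  LocallyIntegrable w volume ∧ (∀ x, 0 ≤ w x) ∧ ∀ᵐ x ∂(volume : Measure (Rn n)), 0 < w x

/-- The Muckenhoupt `A_1` condition with constant `C`. -/
def MuckA1With (w : Rn n → ℝ) (C : ℝ) : Prop :=
  ∀ Q : Set (Rn n), IsCube Q → ∀ᵐ x ∂(volume : Measure (Rn n)), x ∈ Q → cubeAvg Q w ≤ C * w x

/-- The Muckenhoupt `A_r` condition (`1 < r`) with constant `C`. -/
def MuckArWith (w : Rn n → ℝ) (r C : ℝ) : Prop :=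
  ∀ Q : Set (Rn n), IsCube Q →
    cubeAvg Q w * (cubeAvg Q fun x => w x ^ (1 - r / (r - 1))) ^ (r - 1) ≤ C

/-- The Muckenhoupt `A_r` condition, `r ≥ 1`. -/
def MuckA (w : Rn n → ℝ) (r : ℝ) : Prop :=
  (r = 1 ∧ ∃ C : ℝ, 0 < C ∧ MuckA1With w C) ∨
  (1 < r ∧ ∃ C : ℝ, 0 < C ∧ MuckArWith w r C)

/-- The class `A_∞ = ⋃_{r ≥ 1} A_r`. -/
def AInfty (w : Rn n → ℝ) : Prop := ∃ r : ℝ, 1 ≤ r ∧ MuckA w r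

/-- `r_w = inf { r ≥ 1 : w ∈ A_r }`. -/
def rIdx (w : Rn n → ℝ) : ℝ := sInf {r : ℝ | 1 ≤ r ∧ MuckA w r}

/-- The reverse Hölder condition `RH_s` with constant `C`. -/
def RHWith (w : Rn n → ℝ) (s C : ℝ) : Prop :=
  ∀ Q : Set (Rn n), IsCube Q → (cubeAvg Q fun x => w x ^ s) ^ (1/s) ≤ C * cubeAvg Q w

/-- The reverse Hölder class `RH_s`, `1 < s < ∞`. -/
def RH (w : Rn n → ℝ) (s : ℝ) : Prop := ∃ C : ℝ, 0 < C ∧ RHWith w s C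

/-- The reverse Hölder class `RH_∞`. -/
def RHInfty (w : Rn n → ℝ) : Prop :=
  ∃ C : ℝ, 0 < C ∧ ∀ Q : Set (Rn n), IsCube Q →
    ∀ᵐ x ∂(volume : Measure (Rn n)), x ∈ Q → w x ≤ C * cubeAvg Q w

/-- The weighted Lebesgue quasi-norm `‖f‖_{L^p(w)}`. -/
def weightedLp (p : ℝ) (w : Rn n → ℝ) (f : Rn n → ℝ) : ℝ≥0∞ :=
  (∫⁻ x, ENNReal.ofReal |f x| ^ p * ENNReal.ofReal (w x)) ^ (1/p)

/-- The weighted Lebesgue quasi-norm, for `ℝ≥0∞`-valued functions. -/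
def weightedLpE (p : ℝ) (w : Rn n → ℝ) (F : Rn n → ℝ≥0∞) : ℝ≥0∞ :=
  (∫⁻ x, F x ^ p * ENNReal.ofReal (w x)) ^ (1/p)

/-- The variable Lebesgue quasi-norm `‖F‖_{L^{p(·)}}`, for `ℝ≥0∞`-valued functions. -/
def varLpE (p : Rn n → ℝ) (F : Rn n → ℝ≥0∞) : ℝ≥0∞ :=
  sInf {lam : ℝ≥0∞ | 0 < lam ∧ ∫⁻ x, (F x / lam) ^ (p x) ≤ 1}

/-- The variable Lebesgue quasi-norm `‖f‖_{L^{p(·)}}`. -/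
def varLp (p : Rn n → ℝ) (f : Rn n → ℝ) : ℝ≥0∞ :=
  varLpE p fun x => ENNReal.ofReal |f x|

/-- An exponent function in `𝒫₀`: measurable with values in `(0,∞)`. -/
def ExponentP0 (p : Rn n → ℝ) : Prop := Measurable p ∧ ∀ x, 0 < p x

/-- Log-Hölder continuity, locally and at infinity. -/
def LogHolder (p : Rn n → ℝ) : Prop :=
  (∃ C₀ : ℝ, 0 < C₀ ∧ ∀ x y : Rn n, 0 < ‖x - y‖ → ‖x - y‖ < 1/2 →
      |p x - p y| ≤ C₀ / (-Real.log ‖x - y‖)) ∧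
  (∃ pinf Cinf : ℝ, 0 < Cinf ∧ ∀ x : Rn n, |p x - pinf| ≤ Cinf / Real.log (Real.exp 1 + ‖x‖))

/-- The partial derivative `∂_i f`. -/
def pderiv (i : Fin n) (f : Rn n → ℝ) : Rn n → ℝ :=
  fun x => fderiv ℝ f x (EuclideanSpace.single i 1)

/-- The higher-order partial derivative `∂^β f` for a multi-index `β`. -/
def multiDeriv (β : Fin n → ℕ) (f : Rn n → ℝ) : Rn n → ℝ :=
  (List.finRange n).foldr (fun i g => (pderiv i)^[β i] g) f

/-- An `(N,∞)` atom supported in the cube `Q`. -/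
def IsNAtom (N : ℕ) (a : Rn n → ℝ) (Q : Set (Rn n)) : Prop :=
  Measurable a ∧ (∀ x, |a x| ≤ 1) ∧ IsCube Q ∧ Function.support a ⊆ Q ∧
    ∀ β : Fin n → ℕ, (∑ i, β i) ≤ N → ∫ x, (∏ i, x i ^ β i) * a x = 0

/-- Membership in `𝒪_N`: a smooth compactly supported function with vanishing moments
up to order `N`. -/
def InON (N : ℕ) (f : Rn n → ℝ) : Prop :=
  ContDiff ℝ (⊤ : ℕ∞) f ∧ HasCompactSupport f ∧
    ∀ β : Fin n → ℕ, (∑ i, β i) ≤ N → ∫ x, (∏ i, x i ^ β i) * f x = 0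

/-- Tempered distributions on `ℝⁿ`. -/
abbrev TemperedDist (n : ℕ) := SchwartzMap (Rn n) ℝ →L[ℝ] ℝ

/-- The tempered distribution `u` is represented by the function `f`. -/
def Represents (u : TemperedDist n) (f : Rn n → ℝ) : Prop :=
  ∀ ψ : SchwartzMap (Rn n) ℝ, u ψ = ∫ x, f x * ψ x

/-- Membership in the class `𝒮_{N₀}`:
`∫ (1+|x|)^{N₀} (∑_{|β| ≤ N₀} |∂^β φ(x)|²) dx ≤ 1`. -/
def inSN (N₀ : ℕ) (φ : SchwartzMap (Rn n) ℝ) : Prop :=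
  ∫ x : Rn n, (1 + ‖x‖) ^ N₀ *
      ∑ β : Fin n → Fin (N₀ + 1),
        (if (∑ i, (β i : ℕ)) ≤ N₀ then
          (multiDeriv (fun i => (β i : ℕ)) (fun y => φ y) x) ^ 2 else 0) ≤ 1

/-- The grand maximal function `𝓜_{N₀} u (x) = sup_{φ ∈ 𝒮_{N₀}} sup_{t>0} |φ_t * u (x)|`,
where `φ_t * u (x) = u (y ↦ t^{-n} φ((x-y)/t))`. -/
def grandMax (N₀ : ℕ) (u : TemperedDist n) (x : Rn n) : ℝ≥0∞ :=
  sSup {r : ℝ≥0∞ | ∃ (φ ψ : SchwartzMap (Rn n) ℝ) (t : ℝ), 0 < t ∧ inSN N₀ φ ∧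
      (∀ y, ψ y = ((t ^ n)⁻¹ : ℝ) * φ (t⁻¹ • (x - y))) ∧ r = ENNReal.ofReal |u ψ|}

/-- The weighted Hardy space quasi-norm `‖u‖_{H^p(w)} = ‖𝓜_{N₀} u‖_{L^p(w)}`. -/
def hardyNorm (N₀ : ℕ) (p : ℝ) (w : Rn n → ℝ) (u : TemperedDist n) : ℝ≥0∞ :=
  weightedLpE p w (grandMax N₀ u)

/-- The variable Hardy space quasi-norm `‖u‖_{H^{p(·)}} = ‖𝓜_{N₀} u‖_{L^{p(·)}}`. -/
def hardyNormVar (N₀ : ℕ) (p : Rn n → ℝ) (u : TemperedDist n) : ℝ≥0∞ :=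
  varLpE p (grandMax N₀ u)

/-- The fractional maximal operator `M_γ` (the Hardy–Littlewood maximal operator if
`γ = 0`). -/
def fracMax (γ : ℝ) (f : Rn n → ℝ) (x : Rn n) : ℝ≥0∞ :=
  ⨆ (Q : Set (Rn n)) (_ : IsCube Q ∧ x ∈ Q),
    volume Q ^ (γ / (n : ℝ)) * ((∫⁻ y in Q, ENNReal.ofReal |f y|) / volume Q)

/-- `T` is bounded on (unweighted) `L²`. -/
def L2Bounded (T : (Rn n → ℝ) → Rn n → ℝ) : Prop :=
  ∃ A : ℝ, 0 < A ∧ ∀ f : Rn n → ℝ, Measurable f →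
    weightedLp 2 (fun _ => 1) (T f) ≤ ENNReal.ofReal A * weightedLp 2 (fun _ => 1) f

/-- The standard kernel size estimate `|K(x,y)| ≤ C|x-y|^{-n}`. -/
def CZKernelSize (K : Rn n → Rn n → ℝ) (C : ℝ) : Prop :=
  ∀ x y : Rn n, x ≠ y → |K x y| ≤ C * ‖x - y‖ ^ (-(n : ℝ))

/-- The standard kernel smoothness (Hölder) estimate of order `δ`. -/
def CZKernelSmooth (K : Rn n → Rn n → ℝ) (δ C : ℝ) : Prop :=
  ∀ x y h : Rn n, x ≠ y → ‖h‖ ≤ ‖x - y‖ / 2 →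
    |K x (y + h) - K x y| + |K (x + h) y - K x y| ≤ C * ‖h‖ ^ δ * ‖x - y‖ ^ (-(n : ℝ) - δ)

/-- A (non-convolution type) Calderón–Zygmund operator: bounded on `L²`, represented off
the support by a kernel `K` satisfying the standard estimates with exponent `δ`. -/
def CZOp (T : (Rn n → ℝ) → Rn n → ℝ) (K : Rn n → Rn n → ℝ) (δ : ℝ) : Prop :=
  L2Bounded T ∧ 0 < δ ∧ δ ≤ 1 ∧
  (∃ C : ℝ, 0 < C ∧ CZKernelSize K C ∧ CZKernelSmooth K δ C) ∧
  ∀ f : Rn n → ℝ, Measurable f → (∃ M : ℝ, ∀ x, |f x| ≤ M) → HasCompactSupport f →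
    ∀ x ∉ tsupport f, T f x = ∫ y, K x y * f y

/-- The higher-order smoothness condition on the kernel:
`|∂_y^β K(x,y+h) - ∂_y^β K(x,y)| ≤ C |h|^δ |x-y|^{-(n+m+δ)}` for all `|β| = m`. -/
def KernelHigherSmooth (K : Rn n → Rn n → ℝ) (δ : ℝ) (m : ℕ) (C : ℝ) : Prop :=
  (∀ x : Rn n, ContDiffOn ℝ m (fun z => K x z) {x}ᶜ) ∧
  ∀ β : Fin n → ℕ, (∑ i, β i) = m →
    ∀ x y h : Rn n, x ≠ y → ‖h‖ ≤ ‖x - y‖ / 2 →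
      |multiDeriv β (fun z => K x z) (y + h) - multiDeriv β (fun z => K x z) y|
        ≤ C * ‖h‖ ^ δ * ‖x - y‖ ^ (-((n : ℝ) + m + δ))

/-- `T` has `L` vanishing moments: `∫ x^β T a(x) dx = 0` for all `(L+1,∞)` atoms `a` and
all multi-indices `|β| ≤ L`.  (Vacuous if `L = -1`.) -/
def VanishingMoments (T : (Rn n → ℝ) → Rn n → ℝ) (L : ℤ) : Prop :=
  ∀ (a : Rn n → ℝ) (Q : Set (Rn n)), IsNAtom (L + 1).toNat a Q →
    ∀ β : Fin n → ℕ, (∑ i, (β i : ℤ)) ≤ L → ∫ x, (∏ i, x i ^ β i) * T a x = 0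

/-- Regularity of order `N+1` for a convolution kernel:
`|∂^α K(x)| ≤ A |x|^{-n-|α|}` for all `|α| ≤ N+1`. -/
def ConvKernelReg (K : Rn n → ℝ) (N : ℕ) : Prop :=
  ContDiffOn ℝ (N + 1 : ℕ) K {0}ᶜ ∧
  ∃ A : ℝ, 0 < A ∧ ∀ β : Fin n → ℕ, (∑ i, β i) ≤ N + 1 →
    ∀ x : Rn n, x ≠ 0 → |multiDeriv β K x| ≤ A * ‖x‖ ^ (-(n : ℝ) - (∑ i, β i))

/-- A Calderón–Zygmund singular integral operator of convolution type with regularity of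
order `N+1`: `T` is bounded on `L²` (equivalently, the kernel has bounded Fourier
transform), and `T f(x) = p.v. ∫ K(x-y) f(y) dy` for `f ∈ C_c^∞`. -/
def ConvCZO (T : (Rn n → ℝ) → Rn n → ℝ) (K : Rn n → ℝ) (N : ℕ) : Prop :=
  L2Bounded T ∧ ConvKernelReg K N ∧
  ∀ f : Rn n → ℝ, ContDiff ℝ (⊤ : ℕ∞) f → HasCompactSupport f → ∀ x : Rn n,
    Tendsto (fun ε : ℝ => ∫ y in {y : Rn n | ε < ‖x - y‖}, K (x - y) * f y)
      (𝓝[>] 0) (𝓝 (T f x))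

/-- The fractional integral operator `I_α`. -/
def fracInt (α : ℝ) (f : Rn n → ℝ) (x : Rn n) : ℝ :=
  ∫ y, f y * ‖x - y‖ ^ (α - (n : ℝ))

/-- The radial maximal function `M_φ g(x) = sup_{t>0} |φ_t * g(x)|` of a function `g`. -/
def MphiSup (φ : Rn n → ℝ) (g : Rn n → ℝ) (x : Rn n) : ℝ≥0∞ :=
  ⨆ (t : ℝ) (_ : 0 < t), ENNReal.ofReal |∫ y, (t ^ n)⁻¹ * φ (t⁻¹ • (x - y)) * g y|

/-- The iterated partial derivative `∂_{i₁} ⋯ ∂_{iₖ} f` along a list of indices. -/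
def listDeriv (L : List (Fin n)) (f : Rn n → ℝ) : Rn n → ℝ := L.foldr pderiv f

theorem pderiv_eqOn {U : Set (Rn n)} (hU : IsOpen U) {f g : Rn n → ℝ} (h : Set.EqOn f g U)
    (i : Fin n) : Set.EqOn (pderiv i f) (pderiv i g) U := fun x hx => by
  simp only [pderiv, (h.eventuallyEq_of_mem (hU.mem_nhds hx)).fderiv_eq]

theorem contDiffOn_pderiv {U : Set (Rn n)} (hU : IsOpen U) {f : Rn n → ℝ} {k : ℕ}
    (hf : ContDiffOn ℝ (k + 1 : ℕ) f U) (i : Fin n) : ContDiffOn ℝ k (pderiv i f) U :=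
  (hf.fderiv_of_isOpen hU (by norm_cast)).clm_apply contDiffOn_const

theorem contDiffOn_listDeriv {U : Set (Rn n)} (hU : IsOpen U) {f : Rn n → ℝ} (L : List (Fin n))
    {k : ℕ} (hf : ContDiffOn ℝ (k + L.length : ℕ) f U) : ContDiffOn ℝ k (listDeriv L f) U := by
  induction L generalizing k with
  | nil => exact hf
  | cons i L ih =>
    refine contDiffOn_pderiv hU (ih ?_) i
    simpa [add_comm, add_left_comm, add_assoc] using hf

theorem pderiv_comm {U : Set (Rn n)} (hU : IsOpen U) {f : Rn n → ℝ} (hf : ContDiffOn ℝ 2 f U)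
    (i j : Fin n) : Set.EqOn (pderiv i (pderiv j f)) (pderiv j (pderiv i f)) U := fun x hx => by
  have hfx : ContDiffAt ℝ 2 f x := hf.contDiffAt (hU.mem_nhds hx)
  have hd : DifferentiableAt ℝ (fderiv ℝ f) x :=
    (hfx.fderiv_right (m := 1) (by norm_num)).differentiableAt (by norm_num)
  have key (v w : Rn n) : fderiv ℝ (fun z => fderiv ℝ f z v) x w = fderiv ℝ (fderiv ℝ f) x w v := by
    rw [fderiv_clm_apply hd (differentiableAt_const v)]
    simp
  change fderiv ℝ (fun z => fderiv ℝ f z _) x _ = fderiv ℝ (fun z => fderiv ℝ f z _) x _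
  rw [key, key]
  exact hfx.isSymmSndFDerivAt (by simp) _ _

theorem listDeriv_perm {U : Set (Rn n)} (hU : IsOpen U) {f : Rn n → ℝ} {L L' : List (Fin n)}
    (h : L.Perm L') (hf : ContDiffOn ℝ L.length f U) :
    Set.EqOn (listDeriv L f) (listDeriv L' f) U := by
  induction h with
  | nil => exact fun _ _ => rfl
  | cons i _ ih => exact pderiv_eqOn hU (ih (hf.of_le (by simp))) i
  | swap i j L =>
    refine pderiv_comm hU (contDiffOn_listDeriv hU (k := 2) L ?_) j i
    simpa [add_comm, add_left_comm, add_assoc, one_add_one_eq_two] using hf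
  | trans h₁ _ ih₁ ih₂ => exact (ih₁ hf).trans (ih₂ (h₁.length_eq ▸ hf))

theorem multiDeriv_eq_listDeriv (β : Fin n → ℕ) (f : Rn n → ℝ) :
    multiDeriv β f = listDeriv ((List.finRange n).flatMap fun i => List.replicate (β i) i) f := by
  unfold multiDeriv listDeriv
  induction List.finRange n with
  | nil => rfl
  | cons i L ih =>
    rw [List.flatMap_cons, List.foldr_append, ← ih, List.foldr_cons]
    generalize List.foldr _ f L = g
    induction β i with
    | zero => rfl
    | succ k ihk => rw [Function.iterate_succ_apply', List.replicate_succ, List.foldr_cons, ihk]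

theorem listDeriv_eqOn_multiDeriv {U : Set (Rn n)} (hU : IsOpen U) {f : Rn n → ℝ}
    (L : List (Fin n)) (hf : ContDiffOn ℝ L.length f U) :
    Set.EqOn (listDeriv L f) (multiDeriv (fun i => L.count i) f) U := by
  rw [multiDeriv_eq_listDeriv]
  refine listDeriv_perm hU ?_ hf
  rw [List.perm_iff_count]
  intro i
  simp only [List.count_flatMap, Function.comp_def, List.count_replicate, beq_iff_eq]
  rw [← Fin.sum_univ_def]
  simp

theorem sum_count_eq_length (L : List (Fin n)) : ∑ i, L.count i = L.length := by
  simpa using Multiset.sum_count_eq_card (s := Finset.univ) (m := (L : Multiset (Fin n))) (by simp)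

/-- The `k`-th derivative of `t ↦ f (c + t h)`, in terms of the partial derivatives of `f`. -/
def lineDerivSum (f : Rn n → ℝ) (c h : Rn n) (k : ℕ) (t : ℝ) : ℝ :=
  ∑ s : Fin k → Fin n, (∏ j, h (s j)) * listDeriv (List.ofFn s) f (c + t • h)

theorem hasDerivAt_lineDerivSum {U : Set (Rn n)} (hU : IsOpen U) {f : Rn n → ℝ} {N k : ℕ}
    (hf : ContDiffOn ℝ N f U) (hk : k < N) (c h : Rn n) {t : ℝ} (ht : c + t • h ∈ U) :
    HasDerivAt (lineDerivSum f c h k) (lineDerivSum f c h (k + 1) t) t := by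
  have hsplit : lineDerivSum f c h (k + 1) t = ∑ s : Fin k → Fin n, (∏ j, h (s j)) *
      ∑ i, h i * pderiv i (listDeriv (List.ofFn s) f) (c + t • h) := by
    rw [lineDerivSum, ← (Fin.consEquiv fun _ => Fin n).sum_comp, Fintype.sum_prod_type,
      Finset.sum_comm]
    refine Finset.sum_congr rfl fun s _ => ?_
    rw [Finset.mul_sum]
    refine Finset.sum_congr rfl fun i _ => ?_
    simp [Fin.consEquiv, Fin.prod_univ_succ, List.ofFn_succ, listDeriv]
    ring
  rw [hsplit]
  refine HasDerivAt.fun_sum fun s _ => HasDerivAt.const_mul _ ?_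
  have hg : ContDiffOn ℝ (1 : ℕ) (listDeriv (List.ofFn s) f) U :=
    contDiffOn_listDeriv hU _ (hf.of_le (by simp only [List.length_ofFn]; norm_cast; omega))
  have hd := ((hg.contDiffAt (hU.mem_nhds ht)).differentiableAt (by norm_num)).hasFDerivAt
  have hl : HasDerivAt (fun t : ℝ => c + t • h) h t := by
    simpa using ((hasDerivAt_id t).smul_const h).const_add c
  refine (hd.comp_hasDerivAt t hl).congr_deriv ?_
  have hh : h = ∑ i, h i • EuclideanSpace.single i (1 : ℝ) := by
    simpa using ((EuclideanSpace.basisFun (Fin n) ℝ).sum_repr h).symm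
  refine (congrArg (fderiv ℝ (listDeriv (List.ofFn s) f) (c + t • h)) hh).trans ?_
  simp [pderiv]

theorem iteratedDerivWithin_line {U : Set (Rn n)} (hU : IsOpen U) {f : Rn n → ℝ} {N : ℕ}
    (hf : ContDiffOn ℝ N f U) {c h : Rn n} (hs : ∀ t ∈ Set.Icc (0 : ℝ) 1, c + t • h ∈ U)
    {k : ℕ} (hk : k ≤ N) :
    Set.EqOn (iteratedDerivWithin k (fun t : ℝ => f (c + t • h)) (Set.Icc 0 1))
      (lineDerivSum f c h k) (Set.Icc 0 1) := by
  induction k with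
  | zero => intro t _; simp [lineDerivSum, listDeriv]
  | succ k ih =>
    intro t ht
    rw [iteratedDerivWithin_succ, derivWithin_congr (ih (by omega)) (ih (by omega) ht)]
    exact (hasDerivAt_lineDerivSum hU hf hk c h (hs t ht)).hasDerivWithinAt.derivWithin
      (uniqueDiffOn_Icc zero_lt_one t ht)

theorem exists_taylor_remainder {U : Set (Rn n)} (hU : IsOpen U) {f : Rn n → ℝ} {N : ℕ}
    (hf : ContDiffOn ℝ N f U) {c h : Rn n} (hs : ∀ t ∈ Set.Icc (0 : ℝ) 1, c + t • h ∈ U) :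
    ∃ ξ ∈ Set.Icc (0 : ℝ) 1,
      f (c + h) - ∑ k ∈ Finset.range (N + 1), (k.factorial : ℝ)⁻¹ * lineDerivSum f c h k 0
        = (N.factorial : ℝ)⁻¹ * (lineDerivSum f c h N ξ - lineDerivSum f c h N 0) := by
  cases N with
  | zero => exact ⟨1, by simp, by simp [lineDerivSum, listDeriv]⟩
  | succ N =>
    have huIcc : Set.uIcc (0 : ℝ) 1 = Set.Icc 0 1 := Set.uIcc_of_le zero_le_one
    have huIoo : Set.uIoo (0 : ℝ) 1 = Set.Ioo 0 1 := Set.uIoo_of_le zero_le_one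
    have hg : ContDiffOn ℝ (N + 1 : ℕ) (fun t : ℝ => f (c + t • h)) (Set.Icc 0 1) :=
      hf.comp (by fun_prop : ContDiff ℝ (N + 1 : ℕ) fun t : ℝ => c + t • h).contDiffOn hs
    obtain ⟨ξ, hξ, h₁⟩ := taylor_mean_remainder_lagrange (f := fun t : ℝ => f (c + t • h))
      (x := 1) (x₀ := 0) (n := N) zero_ne_one
      (huIcc ▸ hg.of_le (by norm_cast; omega)) (by
        rw [huIcc, huIoo]
        exact (hg.differentiableOn_iteratedDerivWithin (by norm_cast; omega)
          (uniqueDiffOn_Icc zero_lt_one)).mono Set.Ioo_subset_Icc_self)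
    rw [huIoo] at hξ
    rw [huIcc, iteratedDerivWithin_line hU hf hs le_rfl (Set.Ioo_subset_Icc_self hξ),
      taylor_within_apply, Finset.sum_congr rfl fun k hk => by
        rw [iteratedDerivWithin_line hU hf hs (Finset.mem_range.1 hk).le (by simp)]] at h₁
    refine ⟨ξ, Set.Ioo_subset_Icc_self hξ, ?_⟩
    rw [Finset.sum_range_succ]
    simp only [sub_zero, one_pow, mul_one, one_smul, smul_eq_mul] at h₁
    linear_combination h₁

/-- The Taylor polynomial of `f` of degree `N` at `c`. -/
def taylorPoly (f : Rn n → ℝ) (c : Rn n) (N : ℕ) : MvPolynomial (Fin n) ℝ :=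
  ∑ k ∈ Finset.range (N + 1), ∑ s : Fin k → Fin n,
    MvPolynomial.C ((k.factorial : ℝ)⁻¹ * listDeriv (List.ofFn s) f c) *
      ∏ j, (MvPolynomial.X (s j) - MvPolynomial.C (c (s j)))

theorem totalDegree_taylorPoly_le (f : Rn n → ℝ) (c : Rn n) (N : ℕ) :
    (taylorPoly f c N).totalDegree ≤ N := by
  refine MvPolynomial.totalDegree_finsetSum_le fun k hk =>
    MvPolynomial.totalDegree_finsetSum_le fun s _ => ?_
  refine (MvPolynomial.totalDegree_mul _ _).trans ?_
  rw [MvPolynomial.totalDegree_C, zero_add]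
  refine (MvPolynomial.totalDegree_finsetProd _ _).trans ?_
  refine (Finset.sum_le_sum fun j _ => (MvPolynomial.totalDegree_sub_C_le _ _).trans_eq
    (MvPolynomial.totalDegree_X _)).trans ?_
  simpa using Nat.lt_succ_iff.1 (Finset.mem_range.1 hk)

theorem eval_taylorPoly (f : Rn n → ℝ) (c h : Rn n) (N : ℕ) :
    MvPolynomial.eval (fun i => (c + h) i) (taylorPoly f c N)
      = ∑ k ∈ Finset.range (N + 1), (k.factorial : ℝ)⁻¹ * lineDerivSum f c h k 0 := by
  simp only [taylorPoly, lineDerivSum, map_sum, map_mul, map_prod, map_sub, MvPolynomial.eval_C,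
    MvPolynomial.eval_X, Finset.mul_sum]
  refine Finset.sum_congr rfl fun k _ => Finset.sum_congr rfl fun s _ => ?_
  simp
  ring

theorem abs_apply_le_norm (x : Rn n) (i : Fin n) : |x i| ≤ ‖x‖ := PiLp.norm_apply_le x i

theorem norm_le_sqrt_mul {x : Rn n} {r : ℝ} (hr : 0 ≤ r) (hx : ∀ i, |x i| ≤ r) :
    ‖x‖ ≤ √n * r := by
  rw [EuclideanSpace.norm_eq, ← Real.sqrt_sq hr, ← Real.sqrt_mul (Nat.cast_nonneg n)]
  refine Real.sqrt_le_sqrt ((Finset.sum_le_sum fun i _ =>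
    pow_le_pow_left₀ (norm_nonneg _) (hx i) 2).trans_eq ?_)
  simp

theorem abs_sub_eval_taylorPoly_le {K : Rn n → Rn n → ℝ} {δ C : ℝ} {N : ℕ} (hC : 0 ≤ C)
    (hδ : 0 ≤ δ) (hK : KernelHigherSmooth K δ N C) {x c h : Rn n} (hxc : x ≠ c)
    (hh : ‖h‖ ≤ ‖x - c‖ / 2) :
    |K x (c + h) - MvPolynomial.eval (fun i => (c + h) i) (taylorPoly (K x) c N)|
      ≤ n ^ N * ‖h‖ ^ N * (C * ‖h‖ ^ δ * ‖x - c‖ ^ (-((n : ℝ) + N + δ))) := by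
  have hpos : 0 < ‖x - c‖ := norm_pos_iff.2 (sub_ne_zero.2 hxc)
  have hth : ∀ t ∈ Set.Icc (0 : ℝ) 1, ‖t • h‖ ≤ ‖h‖ := fun t ht => by
    rw [norm_smul, Real.norm_eq_abs, abs_of_nonneg ht.1]
    exact mul_le_of_le_one_left (norm_nonneg _) ht.2
  have hs : ∀ t ∈ Set.Icc (0 : ℝ) 1, c + t • h ∈ ({x}ᶜ : Set (Rn n)) := by
    rintro t ht rfl
    have := hth t ht
    rw [add_sub_cancel_left] at hh hpos
    linarith
  have hU : IsOpen ({x}ᶜ : Set (Rn n)) := isOpen_compl_singleton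
  obtain ⟨ξ, hξ, hrem⟩ := exists_taylor_remainder hU (hK.1 x) hs
  rw [eval_taylorPoly, hrem, abs_mul, abs_of_nonneg (by positivity)]
  have hfact : (N.factorial : ℝ)⁻¹ ≤ 1 :=
    inv_le_one_of_one_le₀ (by exact_mod_cast N.factorial_pos)
  refine (mul_le_of_le_one_left (abs_nonneg _) hfact).trans ?_
  rw [lineDerivSum, lineDerivSum, ← Finset.sum_sub_distrib]
  refine (Finset.abs_sum_le_sum_abs _ _).trans ?_
  have hterm : ∀ s ∈ (Finset.univ : Finset (Fin N → Fin n)),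
      |(∏ j, h (s j)) * listDeriv (List.ofFn s) (K x) (c + ξ • h) -
        (∏ j, h (s j)) * listDeriv (List.ofFn s) (K x) (c + (0 : ℝ) • h)|
      ≤ ‖h‖ ^ N * (C * ‖h‖ ^ δ * ‖x - c‖ ^ (-((n : ℝ) + N + δ))) := by
    intro s _
    have hcont : ContDiffOn ℝ (List.ofFn s).length (K x) {x}ᶜ := by simpa using hK.1 x
    rw [← mul_sub, abs_mul, Finset.abs_prod]
    refine mul_le_mul ?_ ?_ (abs_nonneg _) (by positivity)
    · refine (Finset.prod_le_prod (fun _ _ => abs_nonneg _)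
        fun j _ => abs_apply_le_norm h (s j)).trans_eq ?_
      simp
    · rw [listDeriv_eqOn_multiDeriv hU _ hcont (hs ξ hξ),
        listDeriv_eqOn_multiDeriv hU _ hcont (hs 0 (by simp)), zero_smul, add_zero]
      refine (hK.2 _ ((sum_count_eq_length _).trans (by simp)) x c (ξ • h) hxc
        ((hth ξ hξ).trans hh)).trans ?_
      gcongr
      exact hth ξ hξ
  refine (Finset.sum_le_card_nsmul _ _ _ hterm).trans_eq ?_
  simp [mul_assoc]

theorem stdCube_eq_preimage (c : Rn n) (r : ℝ) :
    stdCube c r = WithLp.ofLp ⁻¹' Set.Icc (fun i => c i - r) (fun i => c i + r) := by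
  ext y
  simp only [stdCube, Set.mem_ofPred_eq, Set.mem_preimage, Set.mem_Icc, Pi.le_def, abs_le,
    ← forall_and]
  exact forall_congr' fun i => by constructor <;> rintro ⟨_, _⟩ <;> constructor <;> linarith

theorem isCompact_stdCube (c : Rn n) (r : ℝ) : IsCompact (stdCube c r) := by
  rw [stdCube_eq_preimage]
  exact (PiLp.homeomorph 2 fun _ : Fin n => ℝ).isCompact_preimage.2 isCompact_Icc

theorem volume_real_stdCube (c : Rn n) {r : ℝ} (hr : 0 ≤ r) :
    volume.real (stdCube c r) = (2 * r) ^ n := by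
  rw [stdCube_eq_preimage, measureReal_def,
    (PiLp.volume_preserving_ofLp (Fin n)).measure_preimage measurableSet_Icc.nullMeasurableSet,
    Real.volume_Icc_pi_toReal fun i => by linarith]
  simp [show ∀ i, c i + r - (c i - r) = 2 * r from fun i => by ring]

theorem integrable_mul_of_continuousOn {g a : Rn n → ℝ} {Q : Set (Rn n)} (hQ : IsCompact Q)
    (hg : ContinuousOn g Q) (ha : Measurable a) (ha1 : ∀ x, |a x| ≤ 1)
    (hsupp : Function.support a ⊆ Q) : Integrable (fun x => g x * a x) := by
  rw [← integrableOn_iff_integrable_of_support_subset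
    ((Function.support_mul_subset_right _ _).trans hsupp)]
  exact Integrable.mul_bdd (c := 1) (hg.integrableOn_compact hQ) ha.aestronglyMeasurable
    (Eventually.of_forall ha1)

theorem IsNAtom.integral_eval_mul_eq_zero {N : ℕ} {a : Rn n → ℝ} {c : Rn n} {r : ℝ}
    (ha : IsNAtom N a (stdCube c r)) {p : MvPolynomial (Fin n) ℝ} (hp : p.totalDegree ≤ N) :
    ∫ x : Rn n, MvPolynomial.eval (fun i => x i) p * a x = 0 := by
  simp only [MvPolynomial.eval_eq', Finset.sum_mul, mul_assoc]
  rw [integral_finsetSum]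
  · refine Finset.sum_eq_zero fun d hd => ?_
    rw [integral_const_mul, ha.2.2.2.2 d, mul_zero]
    refine le_trans (le_of_eq ?_) ((MvPolynomial.le_totalDegree hd).trans hp)
    rw [Finsupp.sum_fintype _ _ fun _ => rfl]
  · intro d _
    refine (integrable_mul_of_continuousOn (isCompact_stdCube c r) ?_ ha.1 ha.2.1
      ha.2.2.2.1).const_mul _
    fun_prop

theorem IsNAtom.abs_integral_mul_le {N : ℕ} {a : Rn n → ℝ} {c : Rn n} {r : ℝ} (hr : 0 ≤ r)
    (ha : IsNAtom N a (stdCube c r)) {g : Rn n → ℝ} (hg : ContinuousOn g (stdCube c r))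
    {p : MvPolynomial (Fin n) ℝ} (hp : p.totalDegree ≤ N) {B : ℝ}
    (hB : ∀ x ∈ stdCube c r, |g x - MvPolynomial.eval (fun i => x i) p| ≤ B) :
    |∫ x, g x * a x| ≤ B * (2 * r) ^ n := by
  have hQ := isCompact_stdCube c r
  have hpc : Continuous fun x : Rn n => MvPolynomial.eval (fun i => x i) p :=
    (MvPolynomial.continuous_eval p).comp (by fun_prop)
  have hsub : ∫ x, g x * a x = ∫ x in stdCube c r,
      (g x - MvPolynomial.eval (fun i => x i) p) * a x := by
    rw [setIntegral_eq_integral_of_forall_compl_eq_zero fun x hx => by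
      rw [Function.notMem_support.1 fun h => hx (ha.2.2.2.1 h), mul_zero]]
    simp only [sub_mul]
    rw [integral_sub (integrable_mul_of_continuousOn hQ hg ha.1 ha.2.1 ha.2.2.2.1)
      (integrable_mul_of_continuousOn hQ hpc.continuousOn ha.1 ha.2.1 ha.2.2.2.1),
      ha.integral_eval_mul_eq_zero hp, sub_zero]
  rw [hsub, ← volume_real_stdCube c hr, ← Real.norm_eq_abs]
  refine norm_setIntegral_le_of_norm_le_const hQ.measure_lt_top fun x hx => ?_
  rw [norm_mul]
  exact (mul_le_of_le_one_right (norm_nonneg _) (ha.2.1 x)).trans (hB x hx)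

/-- (Decay of `Ta` outside the dilated cube.)  Let `N ≥ 0` and let `T`
be a Calderón–Zygmund operator whose kernel satisfies
`|∂_y^β K(x,y+h) - ∂_y^β K(x,y)| ≤ C|h|^δ |x-y|^{-(n+N+δ)}` for `|β| = N`.  Then for every
`(N,∞)` atom `a` supported in a cube `Q` with center `c` and side length `ℓ(Q)`, and all
`y ∈ (Q^*)^c`, `|Ta(y)| ≤ C' ℓ(Q)^{n+N+δ} / |y-c|^{n+N+δ}`. -/
theorem stmt19_atom_decay_nonconvolution (n : ℕ) (N : ℕ)
    (T : (Rn n → ℝ) → Rn n → ℝ) (K : Rn n → Rn n → ℝ) (δ : ℝ)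
    (hT : CZOp T K δ)
    (hsm : ∃ C : ℝ, 0 < C ∧ KernelHigherSmooth K δ N C) :
    ∃ C' : ℝ, 0 < C' ∧
      ∀ (a : Rn n → ℝ) (c : Rn n) (r : ℝ), 0 < r → IsNAtom N a (stdCube c r) →
        ∀ y : Rn n, y ∉ stdCube c (2 * Real.sqrt n * r) →
          |T a y| ≤ C' * (2 * r) ^ ((n : ℝ) + N + δ) / ‖y - c‖ ^ ((n : ℝ) + N + δ) := by
  obtain ⟨_, hδ, _, _, hrep⟩ := hT
  obtain ⟨C, hC, hK⟩ := hsm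
  refine ⟨n ^ N * C * √n ^ ((N : ℝ) + δ) + 1, by positivity, fun a c r hr ha y hy => ?_⟩
  have hsn : 0 ≤ √(n : ℝ) * r := by positivity
  have hyc : 2 * (√n * r) < ‖y - c‖ := by
    simp only [stdCube, Set.mem_ofPred_eq, not_forall, not_le] at hy
    obtain ⟨i, hi⟩ := hy
    exact (by linarith : 2 * (√n * r) < |y i - c i|).trans_le (abs_apply_le_norm (y - c) i)
  have hpos : 0 < ‖y - c‖ := by linarith
  have hcube : ∀ z ∈ stdCube c r, ‖z - c‖ ≤ √n * r := fun z hz => norm_le_sqrt_mul hr.le hz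
  have hyQ : y ∉ stdCube c r := fun h => by linarith [hcube y h]
  have hQ := isCompact_stdCube c r
  rw [hrep a ha.1 ⟨1, ha.2.1⟩ (HasCompactSupport.of_support_subset_isCompact hQ ha.2.2.2.1) y
    fun h => hyQ (closure_minimal ha.2.2.2.1 hQ.isClosed h)]
  have hcont : ContinuousOn (K y) (stdCube c r) :=
    (hK.1 y).continuousOn.mono fun z hz => by rintro rfl; exact hyQ hz
  refine (ha.abs_integral_mul_le hr.le hcont (totalDegree_taylorPoly_le (K y) c N)
    (B := n ^ N * (√n * r) ^ N * (C * (√n * r) ^ δ * ‖y - c‖ ^ (-((n : ℝ) + N + δ))))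
    fun z hz => ?_).trans ?_
  · have hz' := hcube z hz
    have h := abs_sub_eval_taylorPoly_le hC.le hδ.le hK (h := z - c)
      (sub_ne_zero.1 (norm_pos_iff.1 hpos)) (by linarith)
    rw [add_sub_cancel] at h
    refine h.trans ?_
    gcongr
  · rw [Real.rpow_neg hpos.le, ← div_eq_mul_inv, mul_div_assoc', div_mul_eq_mul_div]
    refine div_le_div_of_nonneg_right ?_ (by positivity)
    have hsum : (√n * r) ^ N * (√n * r) ^ δ ≤ √n ^ ((N : ℝ) + δ) * (2 * r) ^ ((N : ℝ) + δ) := by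
      rw [← Real.mul_rpow (by positivity) (by positivity), ← Real.rpow_natCast,
        ← Real.rpow_add_of_nonneg hsn (by positivity) hδ.le]
      gcongr
      linarith
    have hsplit : (2 * r) ^ ((n : ℝ) + N + δ) = (2 * r) ^ n * (2 * r) ^ ((N : ℝ) + δ) := by
      rw [add_assoc, Real.rpow_add (by positivity), Real.rpow_natCast]
    calc (n : ℝ) ^ N * (√n * r) ^ N * (C * (√n * r) ^ δ) * (2 * r) ^ n
        = n ^ N * C * ((√n * r) ^ N * (√n * r) ^ δ) * (2 * r) ^ n := by ring
      _ ≤ n ^ N * C * (√n ^ ((N : ℝ) + δ) * (2 * r) ^ ((N : ℝ) + δ)) * (2 * r) ^ n := by gcongr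
      _ = n ^ N * C * √n ^ ((N : ℝ) + δ) * (2 * r) ^ ((n : ℝ) + N + δ) := by rw [hsplit]; ring
      _ ≤ _ := by gcongr; linarith
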